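/- arXiv:1411.5764 — 4 statements merged into one kernel-verified Lean document; each statement's English description precedes it below -/
import Mathlib

section
/- Let ε₀, e₀ ≥ 0 and F, R₀, ν, T, C₀ > 0 be real numbers. Assume (i) ε₀ ≤ C₀·e₀/T + √2·(F/R₀^{3/2})·e₀^{1/2}; (ii) e₀ ≤ (8/π⁴)·(R₀/ν²)·F²; and (iii) T ≥ (2C₀/π²)·R₀²/ν. Then ε₀ ≤ 2√2·(F/R₀^{3/2})·e₀^{1/2}. -/
/-- If the energy is at most `(8 / π ^ 4) (R / ν ^ 2) F ^ 2`, then its square root is at most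
`(2 √2 / π ^ 2) (√R / ν) F`; stated without denominators. -/
theorem sqrt_energy_mul_le {e F R ν : ℝ} (he : 0 ≤ e) (hF : 0 ≤ F) (hR : 0 ≤ R) (hν : 0 < ν)
    (h : e ≤ (8 / Real.pi ^ 4) * (R / ν ^ 2) * F ^ 2) :
    √e * (Real.pi ^ 2 * ν) ≤ 2 * √2 * √R * F := by
  refine le_of_sq_le_sq ?_ (by positivity)
  have hπ := Real.pi_pos
  calc (√e * (Real.pi ^ 2 * ν)) ^ 2 = e * (Real.pi ^ 4 * ν ^ 2) := by
        rw [mul_pow, Real.sq_sqrt he]; ring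
    _ ≤ (8 / Real.pi ^ 4) * (R / ν ^ 2) * F ^ 2 * (Real.pi ^ 4 * ν ^ 2) := by gcongr
    _ = 8 * R * F ^ 2 := by field_simp
    _ = (2 * √2 * √R * F) ^ 2 := by
        simp only [mul_pow, Real.sq_sqrt hR, Real.sq_sqrt zero_le_two]; ring

/-- Under the energy bound and the lower bound on the averaging time, the cut-off
term `C * e / T` is at most `√2 (F / R ^ (3 / 2)) √e`. -/
theorem cutoff_term_le {e F R ν T C : ℝ} (he : 0 ≤ e) (hF : 0 ≤ F) (hR : 0 < R) (hν : 0 < ν)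
    (hT : 0 < T) (h : e ≤ (8 / Real.pi ^ 4) * (R / ν ^ 2) * F ^ 2)
    (hTR : (2 * C / Real.pi ^ 2) * R ^ 2 / ν ≤ T) :
    C * e / T ≤ √2 * (F / √R ^ 3) * √e := by
  have hπ := Real.pi_pos
  have hr : 0 < √R := Real.sqrt_pos.2 hR
  have hTR' : 2 * C * √R ^ 4 ≤ T * (Real.pi ^ 2 * ν) := by
    have hR4 : √R ^ 4 = R ^ 2 := by rw [pow_mul (√R) 2 2, Real.sq_sqrt hR.le]
    rw [hR4, ← div_le_iff₀ (by positivity)]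
    refine (le_of_eq ?_).trans hTR
    field_simp
  have hmul : C * √e * √R ^ 3 ≤ √2 * F * T := by
    refine le_of_mul_le_mul_right ?_ (show 0 < 2 * √R * (Real.pi ^ 2 * ν) by positivity)
    calc C * √e * √R ^ 3 * (2 * √R * (Real.pi ^ 2 * ν))
          = (2 * C * √R ^ 4) * (√e * (Real.pi ^ 2 * ν)) := by ring
      _ ≤ (T * (Real.pi ^ 2 * ν)) * (2 * √2 * √R * F) := by
          refine mul_le_mul hTR' ?_ (by positivity) (by positivity)
          exact sqrt_energy_mul_le he hF hR.le hν h
      _ = √2 * F * T * (2 * √R * (Real.pi ^ 2 * ν)) := by ring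
  calc C * e / T = C * √e * √R ^ 3 * √e / (T * √R ^ 3) := by
        nth_rewrite 1 [← Real.mul_self_sqrt he]
        field_simp
    _ ≤ √2 * F * T * √e / (T * √R ^ 3) := by gcongr
    _ = √2 * (F / √R ^ 3) * √e := by field_simp

/-- Theorem 2 (algebraic content): a priori bound on the energy dissipation rate
on the weak attractor of the periodic 3D Navier–Stokes equations. -/
theorem dissipation_apriori_bound
    (ε₀ e₀ F R₀ ν T C₀ : ℝ)
    (hε₀ : 0 ≤ ε₀) (he₀ : 0 ≤ e₀)
    (hF : 0 < F) (hR₀ : 0 < R₀) (hν : 0 < ν) (hT : 0 < T) (hC₀ : 0 < C₀)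
    (h1 : ε₀ ≤ C₀ * e₀ / T + Real.sqrt 2 * (F / R₀ ^ ((3:ℝ)/2)) * e₀ ^ ((1:ℝ)/2))
    (h2 : e₀ ≤ (8 / Real.pi ^ 4) * (R₀ / ν ^ 2) * F ^ 2)
    (h3 : T ≥ (2 * C₀ / Real.pi ^ 2) * R₀ ^ 2 / ν) :
    ε₀ ≤ 2 * Real.sqrt 2 * (F / R₀ ^ ((3:ℝ)/2)) * e₀ ^ ((1:ℝ)/2) := by
  have hR : R₀ ^ ((3:ℝ)/2) = √R₀ ^ 3 := by
    rw [Real.sqrt_eq_rpow, ← Real.rpow_mul_natCast hR₀.le]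
    norm_num
  rw [hR, ← Real.sqrt_eq_rpow] at h1 ⊢
  linarith [cutoff_term_le he₀ hF.le hR₀ hν hT h2 h3]
end

section
/- Let ε₀, e₀, F, R₀, θ_f, K > 0 be real numbers satisfying: (lkd1) ε₀ ≤ 2√2·(F/R₀^{3/2})·e₀^{1/2}; (lkd2) e₀ ≥ θ_f·F/R₀^{1/2}; and the saturated Kolmogorov dissipation law (satur1) K·e₀^{3/2}/R₀ ≤ ε₀ ≤ (2√2/θ_f)·e₀^{3/2}/R₀. Then: (scal1) (K^{3/2}·θ_f^{3/2}/8^{1/4})·(F/R₀^{3/2})·e₀^{1/2} ≤ ε₀ ≤ 2√2·(F/R₀^{3/2})·e₀^{1/2}; (scal2) θ_f·F/R₀^{1/2} ≤ e₀ ≤ (2√2/K)·F/R₀^{1/2}; and (scal3) K·θ_f^{3/2}·F^{3/2}/R₀^{7/4} ≤ ε₀ ≤ (8^{5/4}/(K^{3/2}·θ_f))·F^{3/2}/R₀^{7/4}. -/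
/-- Every positive real is the `n`-th power of a positive real whose powers realise the
fractional powers with denominator `n`. -/
lemma exists_pos_pow_eq_and_rpow_div {x : ℝ} (hx : 0 < x) {n : ℕ} (hn : n ≠ 0) :
    ∃ y : ℝ, 0 < y ∧ x = y ^ n ∧ ∀ m : ℕ, x ^ ((m : ℝ) / n) = y ^ m := by
  refine ⟨x ^ ((n : ℝ)⁻¹), Real.rpow_pos_of_pos hx _, (Real.rpow_inv_natCast_pow hx.le hn).symm,
    fun m => ?_⟩
  rw [← Real.rpow_natCast, ← Real.rpow_mul hx.le]
  congr 1
  ring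


/-- Theorem 5 (turbulent scaling): the saturated Kolmogorov dissipation law induces
restrictive scalings on the kinetic energy and the energy dissipation rate. -/
theorem turbulent_scaling
    (ε₀ e₀ F R₀ θf K : ℝ)
    (hε₀ : 0 < ε₀) (he₀ : 0 < e₀) (hF : 0 < F) (hR₀ : 0 < R₀) (hθ : 0 < θf) (hK : 0 < K)
    (lkd1 : ε₀ ≤ 2 * Real.sqrt 2 * (F / R₀ ^ ((3:ℝ)/2)) * e₀ ^ ((1:ℝ)/2))
    (lkd2 : e₀ ≥ θf * F / R₀ ^ ((1:ℝ)/2))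
    (satur1l : K * e₀ ^ ((3:ℝ)/2) / R₀ ≤ ε₀)
    (satur1r : ε₀ ≤ (2 * Real.sqrt 2 / θf) * e₀ ^ ((3:ℝ)/2) / R₀) :
    ((K ^ ((3:ℝ)/2) * θf ^ ((3:ℝ)/2) / (8:ℝ) ^ ((1:ℝ)/4)) * (F / R₀ ^ ((3:ℝ)/2)) * e₀ ^ ((1:ℝ)/2) ≤ ε₀ ∧
      ε₀ ≤ 2 * Real.sqrt 2 * (F / R₀ ^ ((3:ℝ)/2)) * e₀ ^ ((1:ℝ)/2)) ∧
    (θf * F / R₀ ^ ((1:ℝ)/2) ≤ e₀ ∧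
      e₀ ≤ (2 * Real.sqrt 2 / K) * F / R₀ ^ ((1:ℝ)/2)) ∧
    (K * θf ^ ((3:ℝ)/2) * F ^ ((3:ℝ)/2) / R₀ ^ ((7:ℝ)/4) ≤ ε₀ ∧
      ε₀ ≤ ((8:ℝ) ^ ((5:ℝ)/4) / (K ^ ((3:ℝ)/2) * θf)) * F ^ ((3:ℝ)/2) / R₀ ^ ((7:ℝ)/4)) := by
  obtain ⟨a, ha, hea, hae⟩ := exists_pos_pow_eq_and_rpow_div he₀ two_ne_zero
  obtain ⟨f, hf, hFf, hfF⟩ := exists_pos_pow_eq_and_rpow_div hF two_ne_zero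
  obtain ⟨t, ht, hθt, htθ⟩ := exists_pos_pow_eq_and_rpow_div hθ two_ne_zero
  obtain ⟨k, hk, hKk, hkK⟩ := exists_pos_pow_eq_and_rpow_div hK two_ne_zero
  obtain ⟨r, hr, hRr, hrR⟩ := exists_pos_pow_eq_and_rpow_div hR₀ four_ne_zero
  obtain ⟨s, hs, h8s, hs8⟩ :=
    exists_pos_pow_eq_and_rpow_div (show (0 : ℝ) < 8 by norm_num) four_ne_zero
  have e1 : e₀ ^ ((1:ℝ)/2) = a := by simpa using hae 1
  have e3 : e₀ ^ ((3:ℝ)/2) = a ^ 3 := by simpa using hae 3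
  have F3 : F ^ ((3:ℝ)/2) = f ^ 3 := by simpa using hfF 3
  have θ3 : θf ^ ((3:ℝ)/2) = t ^ 3 := by simpa using htθ 3
  have K3 : K ^ ((3:ℝ)/2) = k ^ 3 := by simpa using hkK 3
  have R2 : R₀ ^ ((1:ℝ)/2) = r ^ 2 := by
    rw [← hrR 2]; congr 1; norm_num
  have R6 : R₀ ^ ((3:ℝ)/2) = r ^ 6 := by
    rw [← hrR 6]; congr 1; norm_num
  have R7 : R₀ ^ ((7:ℝ)/4) = r ^ 7 := by simpa using hrR 7
  have s1 : (8:ℝ) ^ ((1:ℝ)/4) = s := by simpa using hs8 1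
  have s5 : (8:ℝ) ^ ((5:ℝ)/4) = s ^ 5 := by simpa using hs8 5
  have s2 : 2 * Real.sqrt 2 = s ^ 2 := by
    refine (sq_eq_sq₀ (by positivity) (by positivity)).1 ?_
    rw [mul_pow, Real.sq_sqrt zero_le_two, ← pow_mul, ← h8s]
    norm_num
  rw [e1, R6, s2] at lkd1
  rw [R2] at lkd2
  rw [e3] at satur1l satur1r
  rw [s2] at satur1r
  rw [e1, F3, θ3, K3, R2, R6, R7, s1, s5, s2]
  clear hae hfF htθ hkK hrR hs8 e1 e3 F3 θ3 K3 R2 R6 R7 s1 s5 s2 h8s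
  subst hea hFf hθt hKk hRr
  have lower : t * f ≤ a * r := by
    rw [ge_iff_le, div_le_iff₀ (by positivity), ← mul_pow, ← mul_pow] at lkd2
    exact (sq_le_sq₀ (by positivity) (by positivity)).1 lkd2
  have upper : k * (a * r) ≤ s * f := by
    have h := satur1l.trans lkd1
    field_simp at h
    refine (sq_le_sq₀ (by positivity) (by positivity)).1 ?_
    linarith
  have lower_cube : (t * f) ^ 3 ≤ (a * r) ^ 3 := by gcongr
  have upper_cube : (k * (a * r)) ^ 3 ≤ (s * f) ^ 3 := by gcongr
  have upper_sq : (k * (a * r)) ^ 2 ≤ (s * f) ^ 2 := by gcongr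
  refine ⟨⟨le_trans ?_ satur1l, lkd1⟩, ⟨lkd2, ?_⟩, le_trans ?_ satur1l, satur1r.trans ?_⟩
  · have h : k * (a * r) * (t ^ 3 * f ^ 2) ≤ s * (a * r) ^ 3 :=
      calc k * (a * r) * (t ^ 3 * f ^ 2) ≤ s * f * (t ^ 3 * f ^ 2) := by gcongr
        _ = s * (t * f) ^ 3 := by ring
        _ ≤ s * (a * r) ^ 3 := by gcongr
    have h' : k * t ^ 3 * f ^ 2 ≤ s * (a * r) ^ 2 :=
      le_of_mul_le_mul_right (by linarith) (mul_pos ha hr)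
    calc k ^ 3 * t ^ 3 / s * (f ^ 2 / r ^ 6) * a
        = k * t ^ 3 * f ^ 2 * (k ^ 2 * a / (s * r ^ 6)) := by field_simp
      _ ≤ s * (a * r) ^ 2 * (k ^ 2 * a / (s * r ^ 6)) := by gcongr
      _ = k ^ 2 * a ^ 3 / r ^ 4 := by field_simp
  · calc a ^ 2 = (k * (a * r)) ^ 2 / (k ^ 2 * r ^ 2) := by field_simp
      _ ≤ (s * f) ^ 2 / (k ^ 2 * r ^ 2) := by gcongr
      _ = s ^ 2 / k ^ 2 * f ^ 2 / r ^ 2 := by field_simp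
  · calc k ^ 2 * t ^ 3 * f ^ 3 / r ^ 7 = k ^ 2 * (t * f) ^ 3 / r ^ 7 := by ring
      _ ≤ k ^ 2 * (a * r) ^ 3 / r ^ 7 := by gcongr
      _ = k ^ 2 * a ^ 3 / r ^ 4 := by field_simp
  · calc s ^ 2 / t ^ 2 * a ^ 3 / r ^ 4
        = (k * (a * r)) ^ 3 * (s ^ 2 / (k ^ 3 * t ^ 2 * r ^ 7)) := by field_simp
      _ ≤ (s * f) ^ 3 * (s ^ 2 / (k ^ 3 * t ^ 2 * r ^ 7)) := by gcongr
      _ = s ^ 5 / (k ^ 3 * t ^ 2) * f ^ 3 / r ^ 7 := by field_simp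
end

section
/- Let a < b be reals, E : [a,b] → ℝ a nonnegative bounded function that is continuous at almost every point of [a,b], and G : [a,b] → ℝ a Lebesgue integrable function. Let D ⊆ [a,b] be a set of full Lebesgue measure with a ∈ D, and assume that for every s ∈ D and every t ∈ [s,b] one has E(t) − E(s) ≤ ∫ₛᵗ G(τ) dτ. Then for every twice continuously differentiable function η : [a,b] → ℝ with η ≥ 0, it holds that η(b)·E(b) − η(a)·E(a) − ∫ₐᵇ η′(τ)·E(τ) dτ ≤ ∫ₐᵇ η(τ)·G(τ) dτ. -/
open MeasureTheory intervalIntegral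

open Set Filter Topology

/-- If the increments of `φ` over subintervals of `[a, b]` are bounded by the length of the
subinterval times the decrement of `g`, then `φ b ≤ φ a`. -/
lemma le_of_sub_le_mul_sub_mul_sub {φ g : ℝ → ℝ} {a b : ℝ} (K : ℝ) (hab : a ≤ b)
    (h : ∀ s t, a ≤ s → s ≤ t → t ≤ b → φ t - φ s ≤ K * (t - s) * (g s - g t)) :
    φ b ≤ φ a := by
  have key : ∀ n : ℕ, φ b - φ a ≤ K * (b - a) * (g a - g b) * (1 / ((n : ℝ) + 1)) := by
    intro n
    have hn : (0 : ℝ) < (n : ℝ) + 1 := by positivity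
    set d : ℝ := (b - a) / ((n : ℝ) + 1) with hd
    have hd0 : 0 ≤ d := div_nonneg (by linarith) hn.le
    have hdn : ((n : ℝ) + 1) * d = b - a := by rw [hd]; field_simp
    have hend : a + ((n + 1 : ℕ) : ℝ) * d = b := by push_cast; linarith
    have hstep : ∀ i ∈ Finset.range (n + 1),
        φ (a + ((i + 1 : ℕ) : ℝ) * d) - φ (a + (i : ℝ) * d)
          ≤ K * d * (g (a + (i : ℝ) * d) - g (a + ((i + 1 : ℕ) : ℝ) * d)) := by
      intro i hi
      have hi' : ((i + 1 : ℕ) : ℝ) ≤ ((n + 1 : ℕ) : ℝ) := by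
        exact_mod_cast Finset.mem_range.mp hi
      have h₁ : a + ((i + 1 : ℕ) : ℝ) * d - (a + (i : ℝ) * d) = d := by push_cast; ring
      have h₂ := mul_le_mul_of_nonneg_right hi' hd0
      have h₃ : 0 ≤ (i : ℝ) * d := by positivity
      have := h (a + (i : ℝ) * d) (a + ((i + 1 : ℕ) : ℝ) * d) (by linarith) (by linarith)
        (by linarith)
      rwa [h₁] at this
    have hsum := Finset.sum_le_sum hstep
    rw [← Finset.mul_sum, Finset.sum_range_sub (fun i : ℕ ↦ φ (a + (i : ℝ) * d)),
      Finset.sum_range_sub' (fun i : ℕ ↦ g (a + (i : ℝ) * d)), hend] at hsum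
    simp only [Nat.cast_zero, zero_mul, add_zero] at hsum
    refine hsum.trans_eq ?_
    rw [hd]
    ring
  have hlim : Tendsto (fun n : ℕ ↦ K * (b - a) * (g a - g b) * (1 / ((n : ℝ) + 1)))
      atTop (𝓝 0) := by
    simpa using tendsto_one_div_add_atTop_nhds_zero_nat.const_mul (K * (b - a) * (g a - g b))
  linarith [ge_of_tendsto' hlim key]

/-- An antitone function `g` satisfies the integrated form of `(η g)' ≤ η' g` for `η ≥ 0`. -/
lemma Antitone.mul_sub_mul_le_integral_deriv_mul {g η : ℝ → ℝ} {a b : ℝ} (hg : Antitone g)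
    (hab : a ≤ b) (hη : ContDiff ℝ 1 η) (hη_nonneg : ∀ t ∈ Icc a b, 0 ≤ η t) :
    η b * g b - η a * g a ≤ ∫ τ in a..b, deriv η τ * g τ := by
  have hη' : Continuous (deriv η) := hη.continuous_deriv le_rfl
  obtain ⟨K, hK⟩ := (isCompact_Icc (a := a) (b := b)).exists_bound_of_continuousOn
    hη'.continuousOn
  have hint : ∀ s t, IntervalIntegrable (fun τ ↦ deriv η τ * g τ) volume s t := fun s t ↦
    hg.intervalIntegrable.continuousOn_mul hη'.continuousOn
  have hloc : ∀ s t, a ≤ s → s ≤ t → t ≤ b →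
      (η t * g t - ∫ τ in a..t, deriv η τ * g τ) - (η s * g s - ∫ τ in a..s, deriv η τ * g τ)
        ≤ K * (t - s) * (g s - g t) := by
    intro s t has hst htb
    have hadd := integral_add_adjacent_intervals (hint a s) (hint s t)
    have hftc : ∫ τ in s..t, deriv η τ * g t = (η t - η s) * g t := by
      rw [intervalIntegral.integral_mul_const, integral_deriv_eq_sub
        (fun x _ ↦ (hη.differentiable one_ne_zero) x) (hη'.intervalIntegrable s t)]
    have hint' : IntervalIntegrable (fun τ ↦ deriv η τ * g t) volume s t :=
      (hη'.mul continuous_const).intervalIntegrable s t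
    have hmono : ∫ τ in s..t, (deriv η τ * g t - deriv η τ * g τ)
        ≤ ∫ _ in s..t, K * (g s - g t) := by
      refine integral_mono_on hst (hint'.sub (hint s t)) intervalIntegrable_const ?_
      intro τ hτ
      have h₁ := abs_le.mp (hK τ ⟨has.trans hτ.1, hτ.2.trans htb⟩)
      have h₂ := hg hτ.1
      have h₃ := hg hτ.2
      nlinarith
    rw [intervalIntegral.integral_sub hint' (hint s t), hftc,
      intervalIntegral.integral_const, smul_eq_mul] at hmono
    have hmul := mul_le_mul_of_nonneg_left (hg hst) (hη_nonneg s ⟨has, hst.trans htb⟩)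
    linarith
  have := le_of_sub_le_mul_sub_mul_sub K hab hloc
  simp only [integral_same] at this
  linarith

/-- Integration by parts against the primitive of an integrable function. -/
lemma integral_mul_eq_sub_integral_deriv_mul_primitive {G η : ℝ → ℝ} {a b : ℝ}
    (hG : IntervalIntegrable G volume a b) (hη : ContDiff ℝ 1 η) :
    ∫ τ in a..b, η τ * G τ =
      η b * (∫ σ in a..b, G σ) - ∫ τ in a..b, deriv η τ * ∫ σ in a..τ, G σ := by
  have hparts := hη.contDiffOn.absolutelyContinuousOnInterval.integral_mul_deriv_eq_deriv_mul
    (hG.absolutelyContinuousOnInterval_intervalIntegral left_mem_uIcc)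
  rw [integral_same, mul_zero, sub_zero] at hparts
  rw [← hparts]
  refine integral_congr_ae ?_
  filter_upwards [hG.ae_hasDerivAt_integral] with x hx hxab
  rw [(hx (uIoc_subset_uIcc hxab) a left_mem_uIcc).deriv]

/-- Real-analysis content of Theorem 8 (str_en_ineq): a bounded, nonnegative, a.e. continuous
energy profile E satisfying the Leray–Hopf type inequality from every point of a full-measure
set D (containing a) satisfies the time-localized energy inequality against any nonnegative
C² cut-off η. -/
theorem localized_energy_inequality
    (a b : ℝ) (hab : a < b)
    (E G : ℝ → ℝ)
    (hE_nonneg : ∀ t ∈ Set.Icc a b, 0 ≤ E t)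
    (hE_bdd : ∃ M : ℝ, ∀ t ∈ Set.Icc a b, E t ≤ M)
    (hE_cont : ∀ᵐ t ∂(volume.restrict (Set.Icc a b)), ContinuousAt E t)
    (hG : IntegrableOn G (Set.Icc a b))
    (D : Set ℝ) (hD_sub : D ⊆ Set.Icc a b) (haD : a ∈ D)
    (hD_full : volume (Set.Icc a b \ D) = 0)
    (hEG : ∀ s ∈ D, ∀ t ∈ Set.Icc s b, E t - E s ≤ ∫ τ in s..t, G τ)
    (η : ℝ → ℝ) (hη : ContDiff ℝ 2 η) (hη_nonneg : ∀ t ∈ Set.Icc a b, 0 ≤ η t) :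
    η b * E b - η a * E a - ∫ τ in a..b, deriv η τ * E τ ≤ ∫ τ in a..b, η τ * G τ := by
  have hGab : IntervalIntegrable G volume a b :=
    (intervalIntegrable_iff_integrableOn_Icc_of_le hab.le).mpr hG
  have hη₁ : ContDiff ℝ 1 η := hη.of_le one_le_two
  have hη' : Continuous (deriv η) := hη₁.continuous_deriv le_rfl
  set F : ℝ → ℝ := fun x ↦ ∫ σ in a..x, G σ
  have hGsub : ∀ t ∈ Icc a b, IntervalIntegrable G volume a t := fun t ht ↦
    hGab.mono_set (by
      rw [uIcc_of_le ht.1, uIcc_of_le hab.le]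
      exact Icc_subset_Icc_right ht.2)
  have hdrop : ∀ s ∈ D, ∀ t ∈ Icc s b, E t - F t ≤ E s - F s := by
    intro s hs t ht
    have h₁ := hEG s hs t ht
    rw [← integral_interval_sub_left (hGsub t ⟨(hD_sub hs).1.trans ht.1, ht.2⟩)
      (hGsub s (hD_sub hs))] at h₁
    linarith
  have hsub : insert b D ⊆ Icc a b := insert_subset (right_mem_Icc.mpr hab.le) hD_sub
  have hanti : AntitoneOn (fun t ↦ E t - F t) (insert b D) := by
    intro s hs t ht hst
    rcases hs with rfl | hs
    · exact (congrArg (fun x ↦ E x - F x) (le_antisymm (hsub ht).2 hst)).le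
    · exact hdrop s hs t ⟨hst, (hsub ht).2⟩
  obtain ⟨g, hg, hgE⟩ := hanti.exists_antitone_extension
    ⟨E b - F b, by
      rintro _ ⟨t, ht, rfl⟩
      exact hanti ht (mem_insert b D) (hsub ht).2⟩
    ⟨E a - F a, by
      rintro _ ⟨t, ht, rfl⟩
      exact hanti (mem_insert_of_mem b haD) ht (hsub ht).1⟩
  have hgb : E b - F b = g b := hgE (mem_insert b D)
  have hga : E a - F a = g a := hgE (mem_insert_of_mem b haD)
  have hFa : F a = 0 := integral_same
  have hFcont : ContinuousOn F (uIcc a b) :=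
    (hGab.absolutelyContinuousOnInterval_intervalIntegral left_mem_uIcc).continuousOn
  have hE_eq : ∫ τ in a..b, deriv η τ * E τ
      = (∫ τ in a..b, deriv η τ * g τ) + ∫ τ in a..b, deriv η τ * F τ := by
    rw [← intervalIntegral.integral_add
      (hg.intervalIntegrable.continuousOn_mul hη'.continuousOn)
      (hFcont.intervalIntegrable.continuousOn_mul hη'.continuousOn)]
    refine integral_congr_ae ?_
    filter_upwards [measure_eq_zero_iff_ae_notMem.mp hD_full] with x hx hxab
    rw [uIoc_of_le hab.le] at hxab
    have hxD : x ∈ D := by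
      by_contra hxD
      exact hx ⟨Ioc_subset_Icc_self hxab, hxD⟩
    have hgx : E x - F x = g x := hgE (mem_insert_of_mem b hxD)
    rw [← hgx]
    ring
  have hmain := hg.mul_sub_mul_le_integral_deriv_mul hab.le hη₁ hη_nonneg
  have hparts : ∫ τ in a..b, η τ * G τ = η b * F b - ∫ τ in a..b, deriv η τ * F τ :=
    integral_mul_eq_sub_integral_deriv_mul_primitive hGab hη₁
  rw [← hgb, ← hga, hFa] at hmain
  rw [hE_eq, hparts]
  linarith
end

section
/- Let e₀, ε₀, F, R₀, ν, T, C₀, K > 0 and K₂ ≥ 1 be real numbers, and let I and J be real numbers. Assume: (i) I ≥ ε₀ − C₀·e₀/T; (ii) ε₀ ≥ (2√2/K)·(F/R₀^{3/2})·e₀^{1/2}; (iii) e₀ ≤ (8/π⁴)·(R₀/ν²)·F²; (iv) T ≥ (4K·C₀/π²)·R₀²/ν; and (v) |J| ≤ √2·K₂·(F/R₀^{3/2})·e₀^{1/2}. Then I ≥ (√2/K)·(F/R₀^{3/2})·e₀^{1/2} and |J| ≤ K·K₂·I. -/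
/-- Lemma 1 (ll1) of Section 5, algebraic content: under the saturated dissipation lower
bound, the weak-attractor energy bound and the time-length condition, the normalized
force–velocity pairing I is bounded below, and the cut-off-weighted pairing J satisfies
|J| ≤ K·K₂·I. -/
theorem force_velocity_pairing_bound
    (e₀ ε₀ F R₀ ν T C₀ K K₂ I J : ℝ)
    (he₀ : 0 < e₀) (hε₀ : 0 < ε₀) (hF : 0 < F) (hR₀ : 0 < R₀) (hν : 0 < ν)
    (hT : 0 < T) (hC₀ : 0 < C₀) (hK : 0 < K) (hK₂ : 1 ≤ K₂)
    (h1 : I ≥ ε₀ - C₀ * e₀ / T)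
    (h2 : ε₀ ≥ (2 * Real.sqrt 2 / K) * (F / R₀ ^ ((3:ℝ)/2)) * e₀ ^ ((1:ℝ)/2))
    (h3 : e₀ ≤ (8 / Real.pi ^ 4) * (R₀ / ν ^ 2) * F ^ 2)
    (h4 : T ≥ (4 * K * C₀ / Real.pi ^ 2) * R₀ ^ 2 / ν)
    (h5 : |J| ≤ Real.sqrt 2 * K₂ * (F / R₀ ^ ((3:ℝ)/2)) * e₀ ^ ((1:ℝ)/2)) :
    I ≥ (Real.sqrt 2 / K) * (F / R₀ ^ ((3:ℝ)/2)) * e₀ ^ ((1:ℝ)/2) ∧ |J| ≤ K * K₂ * I := by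
  have hπ := Real.pi_pos
  obtain ⟨r, hr, rfl⟩ : ∃ r : ℝ, 0 < r ∧ R₀ = r ^ 2 :=
    ⟨√R₀, Real.sqrt_pos.2 hR₀, (Real.sq_sqrt hR₀.le).symm⟩
  obtain ⟨s, hs, rfl⟩ : ∃ s : ℝ, 0 < s ∧ e₀ = s ^ 2 :=
    ⟨√e₀, Real.sqrt_pos.2 he₀, (Real.sq_sqrt he₀.le).symm⟩
  have hr_pow : (r ^ 2) ^ ((3 : ℝ) / 2) = r ^ 3 := by
    rw [← Real.rpow_natCast, ← Real.rpow_mul hr.le, ← Real.rpow_natCast]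
    norm_num
  have hs_pow : (s ^ 2) ^ ((1 : ℝ) / 2) = s := by
    rw [← Real.sqrt_eq_rpow, Real.sqrt_sq hs.le]
  rw [hr_pow, hs_pow] at h2 h5 ⊢
  have hw : 0 < √2 := by positivity
  have hw_sq : √2 ^ 2 = 2 := Real.sq_sqrt (by norm_num)
  have energy : s * Real.pi ^ 2 * ν ≤ 2 * √2 * r * F := by
    refine (pow_le_pow_iff_left₀ (by positivity) (by positivity) two_ne_zero).1 ?_
    have h : s ^ 2 * (Real.pi ^ 4 * ν ^ 2) ≤ 8 * r ^ 2 * F ^ 2 := by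
      rw [← le_div_iff₀ (by positivity)]
      exact h3.trans_eq (by field_simp)
    calc (s * Real.pi ^ 2 * ν) ^ 2 = s ^ 2 * (Real.pi ^ 4 * ν ^ 2) := by ring
      _ ≤ 8 * r ^ 2 * F ^ 2 := h
      _ = (2 * √2 * r * F) ^ 2 := by
        linear_combination (-4 * r ^ 2 * F ^ 2) * hw_sq
  have time : 4 * K * C₀ * r ^ 4 ≤ T * (Real.pi ^ 2 * ν) := by
    rw [← div_le_iff₀ (by positivity)]
    exact le_trans (le_of_eq (by field_simp)) h4
  have key : C₀ * s * K * r ^ 3 ≤ √2 * F * T := by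
    have h : 2 * r * (2 * (C₀ * s * K * r ^ 3)) ≤ 2 * r * (√2 * F * T) := by
      nlinarith [mul_le_mul_of_nonneg_left time hs.le, mul_le_mul_of_nonneg_left energy hT.le]
    have h' := le_of_mul_le_mul_left h (by positivity)
    have : 0 < C₀ * s * K * r ^ 3 := by positivity
    linarith
  have transient : C₀ * s ^ 2 / T ≤ √2 / K * (F / r ^ 3) * s := by
    rw [show √2 / K * (F / r ^ 3) * s = √2 * F * s / (K * r ^ 3) by field_simp,
      div_le_div_iff₀ hT (by positivity)]
    nlinarith [mul_le_mul_of_nonneg_left key hs.le]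
  have lower : √2 / K * (F / r ^ 3) * s ≤ I := by
    have h : 2 * √2 / K * (F / r ^ 3) * s = 2 * (√2 / K * (F / r ^ 3) * s) := by ring
    linarith
  refine ⟨lower, h5.trans ?_⟩
  calc √2 * K₂ * (F / r ^ 3) * s = K * K₂ * (√2 / K * (F / r ^ 3) * s) := by field_simp
    _ ≤ K * K₂ * I := mul_le_mul_of_nonneg_left lower (by positivity)
end
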